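/- Let L be the entire continuation of the Cantor Dirichlet series (assumed to exist). Then for every ε > 0 there is a constant K such that for all real t ≥ 2, |L(1/2 + it)| ≤ K·t^{1/8 + ε}. -/

import Mathlib

open Complex Real

/-- `r(n) = ∏_{j=1}^∞ cos(3n/(4·3^j))`: the real cosine product giving the
Fourier coefficients of the ternary Cantor measure rescaled to `[0.5, 2.0]`. -/
noncomputable def cantorR (n : ℕ) : ℝ :=
  ∏' j : ℕ, Real.cos (3 * n / (4 * 3 ^ (j + 1)))

/-- `â(n) = e^{i(5/4)n} r(n)`: the Fourier coefficients of the rescaled ternary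
Cantor measure. -/
noncomputable def cantorA (n : ℕ) : ℂ :=
  Complex.exp (Complex.I * (5 / 4) * n) * (cantorR n : ℂ)

/-- The Cantor Dirichlet series `∑_{n≥1} â(n) n^{-s}` (as a `tsum`). -/
noncomputable def cantorSeries (s : ℂ) : ℂ :=
  ∑' n : ℕ, cantorA (n + 1) * ((n + 1 : ℕ) : ℂ) ^ (-s)

/-- `d = log 2 / log 3`, the Hausdorff dimension of the ternary Cantor set. -/
noncomputable def cantorDim : ℝ := Real.log 2 / Real.log 3

/-- The two-scale cosine weight. -/
noncomputable def ccF (u : ℝ) : ℝ := |Real.cos (3 * u)| * |Real.cos u|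

lemma ccF_add_pi (u : ℝ) : ccF (u + Real.pi) = ccF u := by
  unfold ccF
  have h1 : Real.cos (3 * (u + Real.pi)) = - Real.cos (3 * u) := by
    rw [show 3 * (u + Real.pi) = (3 * u + Real.pi) + 2 * Real.pi by ring, Real.cos_add_two_pi,
      Real.cos_add_pi]
  rw [h1, Real.cos_add_pi, abs_neg, abs_neg]

lemma ccF_three (u : ℝ) (h1 : -(Real.pi / 6) ≤ u) (h2 : u ≤ Real.pi / 6) :
    ccF u + ccF (u + Real.pi / 3) + ccF (u - Real.pi / 3) = Real.cos (4 * u) + Real.cos (2 * u) := by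
  have hpi := Real.pi_pos
  unfold ccF
  have e1 : Real.cos (3 * (u + Real.pi / 3)) = - Real.cos (3 * u) := by
    rw [show 3 * (u + Real.pi / 3) = 3 * u + Real.pi by ring, Real.cos_add_pi]
  have e2 : Real.cos (3 * (u - Real.pi / 3)) = - Real.cos (3 * u) := by
    rw [show 3 * (u - Real.pi / 3) = 3 * u - Real.pi by ring, Real.cos_sub_pi]
  have p0 : 0 ≤ Real.cos (3 * u) := Real.cos_nonneg_of_mem_Icc ⟨by linarith, by linarith⟩
  have p1 : 0 ≤ Real.cos u := Real.cos_nonneg_of_mem_Icc ⟨by linarith, by linarith⟩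
  have p2 : 0 ≤ Real.cos (u + Real.pi / 3) := Real.cos_nonneg_of_mem_Icc ⟨by linarith, by linarith⟩
  have p3 : 0 ≤ Real.cos (u - Real.pi / 3) := Real.cos_nonneg_of_mem_Icc ⟨by linarith, by linarith⟩
  rw [e1, e2, abs_neg, abs_of_nonneg p0, abs_of_nonneg p1, abs_of_nonneg p2, abs_of_nonneg p3,
    show 4 * u = 3 * u + u by ring, show 2 * u = 3 * u - u by ring, Real.cos_add (3 * u) u,
    Real.cos_sub (3 * u) u, Real.cos_add u, Real.cos_sub u, Real.cos_pi_div_three]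
  ring

lemma cc_cos_pi_nine : Real.cos (Real.pi / 9) ≤ 0.95 := by
  by_contra h
  push Not at h
  have h3 := Real.cos_three_mul (Real.pi / 9)
  rw [show 3 * (Real.pi / 9) = Real.pi / 3 by ring, Real.cos_pi_div_three] at h3
  nlinarith [sq_nonneg (Real.cos (Real.pi / 9) - 0.95), mul_pos (sub_pos.2 h) (sub_pos.2 h)]

noncomputable def ccS (y : ℝ) : ℝ := ∑ m ∈ Finset.range 9, ccF (y + m * (Real.pi / 9))

lemma ccS_small (y : ℝ) (h1 : -(Real.pi / 18) ≤ y) (h2 : y ≤ Real.pi / 18) : ccS y ≤ 3.9 := by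
  have hpi := Real.pi_pos
  have a0 := ccF_three y (by linarith) (by linarith)
  have a1 := ccF_three (y + Real.pi / 9) (by linarith) (by linarith)
  have a2 := ccF_three (y - Real.pi / 9) (by linarith) (by linarith)
  have b5 := ccF_add_pi (y - Real.pi / 9 - Real.pi / 3)
  have b6 := ccF_add_pi (y - Real.pi / 3)
  have b7 := ccF_add_pi (y + Real.pi / 9 - Real.pi / 3)
  have b8 := ccF_add_pi (y - Real.pi / 9)
  have key : ccS y = (Real.cos (4 * y) + Real.cos (2 * y))
      + (Real.cos (4 * (y + Real.pi / 9)) + Real.cos (2 * (y + Real.pi / 9)))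
      + (Real.cos (4 * (y - Real.pi / 9)) + Real.cos (2 * (y - Real.pi / 9))) := by
    rw [← a0, ← a1, ← a2, ← b5, ← b6, ← b7, ← b8]
    unfold ccS
    simp only [Finset.sum_range_succ, Finset.sum_range_zero]
    push_cast
    ring_nf
  have q1 : Real.cos (4 * (y + Real.pi / 9)) + Real.cos (4 * (y - Real.pi / 9))
      = 2 * Real.cos (4 * Real.pi / 9) * Real.cos (4 * y) := by
    rw [show 4 * (y + Real.pi / 9) = 4 * y + 4 * Real.pi / 9 by ring,
      show 4 * (y - Real.pi / 9) = 4 * y - 4 * Real.pi / 9 by ring, Real.cos_add, Real.cos_sub]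
    ring
  have q2 : Real.cos (2 * (y + Real.pi / 9)) + Real.cos (2 * (y - Real.pi / 9))
      = 2 * Real.cos (2 * Real.pi / 9) * Real.cos (2 * y) := by
    rw [show 2 * (y + Real.pi / 9) = 2 * y + 2 * Real.pi / 9 by ring,
      show 2 * (y - Real.pi / 9) = 2 * y - 2 * Real.pi / 9 by ring, Real.cos_add, Real.cos_sub]
    ring
  have q3 : Real.cos (4 * Real.pi / 9) + Real.cos (2 * Real.pi / 9) = Real.cos (Real.pi / 9) := by
    rw [show 4 * Real.pi / 9 = Real.pi / 3 + Real.pi / 9 by ring,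
      show 2 * Real.pi / 9 = Real.pi / 3 - Real.pi / 9 by ring, Real.cos_add, Real.cos_sub,
      Real.cos_pi_div_three]
    ring
  have p4 : 0 ≤ Real.cos (4 * Real.pi / 9) :=
    Real.cos_nonneg_of_mem_Icc ⟨by linarith, by linarith⟩
  have p2 : 0 ≤ Real.cos (2 * Real.pi / 9) :=
    Real.cos_nonneg_of_mem_Icc ⟨by linarith, by linarith⟩
  have l4 := Real.cos_le_one (4 * y)
  have l2 := Real.cos_le_one (2 * y)
  have := cc_cos_pi_nine
  rw [key]
  nlinarith [mul_nonneg p4 (sub_nonneg.2 l4), mul_nonneg p2 (sub_nonneg.2 l2)]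

lemma ccS_periodic : Function.Periodic ccS (Real.pi / 9) := by
  intro y
  have b := ccF_add_pi y
  unfold ccS
  simp only [Finset.sum_range_succ, Finset.sum_range_zero]
  push_cast
  have e : y + Real.pi / 9 + 8 * (Real.pi / 9) = y + Real.pi := by ring
  rw [e, b]
  ring_nf

lemma ccS_le (y : ℝ) : ccS y ≤ 3.9 := by
  have hpi := Real.pi_pos
  have h := abs_sub_round (y / (Real.pi / 9))
  have hper : ccS (y - (round (y / (Real.pi / 9)) : ℤ) * (Real.pi / 9)) = ccS y := 
    ccS_periodic.sub_int_mul_eq _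
  rw [← hper]
  rw [abs_le] at h
  have hy : y = (y / (Real.pi / 9)) * (Real.pi / 9) := by field_simp
  set z := y / (Real.pi / 9)
  rw [hy, ← sub_mul]
  apply ccS_small <;> nlinarith

/-- Thickened cosine. -/
noncomputable def ccg (j : ℕ) (x : ℝ) : ℝ := |Real.cos (x * (1 / (4 * 3 ^ j)))| + 1 / (4 * 3 ^ j)

noncomputable def ccG (k : ℕ) (x : ℝ) : ℝ := ccg (2 * k) x * ccg (2 * k + 1) x

noncomputable def ccT (k : ℕ) : ℝ := 4 * Real.pi / 3 * 9 ^ k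

lemma ccg_nonneg (j : ℕ) (x : ℝ) : 0 ≤ ccg j x := by unfold ccg; positivity

lemma ccG_nonneg (k : ℕ) (x : ℝ) : 0 ≤ ccG k x := mul_nonneg (ccg_nonneg _ _) (ccg_nonneg _ _)

lemma ccG_cont (k : ℕ) : Continuous (ccG k) := by unfold ccG ccg; fun_prop

lemma ccG_le (k : ℕ) (x : ℝ) :
    ccG k x ≤ ccF (x * (1 / (4 * 3 ^ (2 * k + 1)))) + 3 * (1 / (4 * 9 ^ k)) := by
  unfold ccG ccg ccF
  have e1 : (3 : ℝ) ^ (2 * k) = 9 ^ k := by rw [pow_mul]; norm_num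
  have e2 : (3 : ℝ) ^ (2 * k + 1) = 3 * 9 ^ k := by rw [pow_succ, e1]; ring
  rw [e2, e1]
  have e3 : 3 * (x * (1 / (4 * (3 * 9 ^ k)))) = x * (1 / (4 * 9 ^ k)) := by field_simp
  have e4 : (1 : ℝ) / (4 * (3 * 9 ^ k)) = (1 / (4 * 9 ^ k)) / 3 := by field_simp
  rw [e3]
  have hd : (1 : ℝ) / (4 * 9 ^ k) ≤ 1 := by
    rw [div_le_one (by positivity)]
    have : (1 : ℝ) ≤ 9 ^ k := one_le_pow₀ (by norm_num)
    linarith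
  have hd0 : (0 : ℝ) ≤ 1 / (4 * 9 ^ k) := by positivity
  have c1 := Real.abs_cos_le_one (x * (1 / (4 * 9 ^ k)))
  have c2 := Real.abs_cos_le_one (x * (1 / (4 * (3 * 9 ^ k))))
  have n1 := abs_nonneg (Real.cos (x * (1 / (4 * 9 ^ k))))
  have n2 := abs_nonneg (Real.cos (x * (1 / (4 * (3 * 9 ^ k)))))
  generalize |Real.cos (x * (1 / (4 * 9 ^ k)))| = a at *
  generalize |Real.cos (x * (1 / (4 * (3 * 9 ^ k))))| = b at *
  rw [e4]
  generalize (1 : ℝ) / (4 * 9 ^ k) = d at *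
  nlinarith [mul_nonneg hd0 (sub_nonneg.2 c1), mul_nonneg hd0 (sub_nonneg.2 c2),
    mul_nonneg hd0 (sub_nonneg.2 hd)]

lemma ccG_sum (k : ℕ) (hk : 3 ≤ k) (x : ℝ) :
    ∑ m ∈ Finset.range 9, ccG k (x + m * ccT k) ≤ 3.91 := by
  have e2 : (3 : ℝ) ^ (2 * k + 1) = 3 * 9 ^ k := by rw [pow_succ, pow_mul]; norm_num; ring
  have h1 : ∑ m ∈ Finset.range 9, ccG k (x + m * ccT k)
      ≤ ∑ m ∈ Finset.range 9, (ccF (x * (1 / (4 * 3 ^ (2 * k + 1))) + m * (Real.pi / 9))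
        + 3 * (1 / (4 * 9 ^ k))) := by
    apply Finset.sum_le_sum
    intro m _
    refine (ccG_le k _).trans (le_of_eq ?_)
    congr 2
    rw [e2, ccT]
    field_simp
    ring
  refine h1.trans ?_
  rw [Finset.sum_add_distrib]
  have h2 := ccS_le (x * (1 / (4 * 3 ^ (2 * k + 1))))
  unfold ccS at h2
  have h3 : (1 : ℝ) / (4 * 9 ^ k) ≤ 1 / (4 * 9 ^ 3) := by
    apply one_div_le_one_div_of_le (by positivity)
    have : (9 : ℝ) ^ 3 ≤ 9 ^ k := pow_le_pow_right₀ (by norm_num) hk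
    linarith
  simp only [Finset.sum_const, Finset.card_range, nsmul_eq_mul]
  norm_num at h2 h3 ⊢
  linarith

lemma ccg_periodic (j : ℕ) : Function.Periodic (ccg j) (4 * Real.pi * 3 ^ j) := by
  intro x
  unfold ccg
  have : (x + 4 * Real.pi * 3 ^ j) * (1 / (4 * 3 ^ j)) = x * (1 / (4 * 3 ^ j)) + Real.pi := by
    field_simp
  rw [this, Real.cos_add_pi, abs_neg]

lemma ccG_periodic (l k : ℕ) (h : l < k) : Function.Periodic (ccG l) (ccT k) := by
  obtain ⟨c, rfl⟩ := Nat.exists_eq_add_of_lt h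
  have h1 : Function.Periodic (ccg (2 * l)) (ccT (l + c + 1)) := by
    have := (ccg_periodic (2 * l)).nat_mul (3 * 9 ^ c)
    have e : ((3 * 9 ^ c : ℕ) : ℝ) * (4 * Real.pi * 3 ^ (2 * l)) = ccT (l + c + 1) := by
      unfold ccT; rw [pow_mul]; push_cast; norm_num; ring
    rwa [e] at this
  have h2 : Function.Periodic (ccg (2 * l + 1)) (ccT (l + c + 1)) := by
    have := (ccg_periodic (2 * l + 1)).nat_mul (9 ^ c)
    have e : ((9 ^ c : ℕ) : ℝ) * (4 * Real.pi * 3 ^ (2 * l + 1)) = ccT (l + c + 1) := by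
      unfold ccT; rw [pow_succ 3, pow_mul]; push_cast; norm_num; ring
    rwa [e] at this
  exact h1.mul h2

noncomputable def ccP (k : ℕ) (x : ℝ) : ℝ := ∏ l ∈ Finset.Ico 3 k, ccG l x

lemma ccP_periodic (k : ℕ) : Function.Periodic (ccP k) (ccT k) := by
  intro x
  unfold ccP
  apply Finset.prod_congr rfl
  intro l hl
  exact ccG_periodic l k (Finset.mem_Ico.1 hl).2 x

lemma ccP_cont (k : ℕ) : Continuous (ccP k) := by
  unfold ccP
  exact continuous_finsetProd _ fun l _ => ccG_cont l

lemma ccP_nonneg (k : ℕ) (x : ℝ) : 0 ≤ ccP k x := Finset.prod_nonneg fun l _ => ccG_nonneg l x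

noncomputable def ccI (k : ℕ) : ℝ := ∫ x in (0 : ℝ)..(ccT k), ccP k x

lemma ccT_pos (k : ℕ) : 0 < ccT k := by unfold ccT; positivity

lemma ccI_succ (k : ℕ) (hk : 3 ≤ k) : ccI (k + 1) ≤ 3.91 * ccI k := by
  have hc : ∀ m : ℕ, Continuous fun x => ccP (k + 1) (x + m * ccT k) := fun m =>
    (ccP_cont (k + 1)).comp (by fun_prop)
  have h1 : ccI (k + 1) = ∑ m ∈ Finset.range 9,
      ∫ x in (0 : ℝ)..(ccT k), ccP (k + 1) (x + m * ccT k) := by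
    have := intervalIntegral.sum_integral_adjacent_intervals (f := ccP (k + 1))
      (μ := MeasureTheory.volume) (a := fun m : ℕ => (m : ℝ) * ccT k) (n := 9)
      (fun m _ => (ccP_cont (k + 1)).intervalIntegrable _ _)
    have e : ((9 : ℕ) : ℝ) * ccT k = ccT (k + 1) := by unfold ccT; push_cast; ring
    rw [e] at this
    unfold ccI
    rw [show ((0 : ℕ) : ℝ) * ccT k = 0 by simp] at this
    rw [← this]
    apply Finset.sum_congr rfl
    intro m _
    rw [intervalIntegral.integral_comp_add_right]
    congr 1
    · ring
    · push_cast; ring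
  rw [h1, ← intervalIntegral.integral_finsetSum fun m _ => (hc m).intervalIntegrable _ _]
  unfold ccI
  rw [← intervalIntegral.integral_const_mul]
  apply intervalIntegral.integral_mono_on (ccT_pos k).le
  · exact (continuous_finsetSum _ fun m _ => hc m).intervalIntegrable _ _
  · exact ((ccP_cont k).const_mul _).intervalIntegrable _ _
  intro x _
  have e : ∀ m : ℕ, ccP (k + 1) (x + m * ccT k) = ccP k x * ccG k (x + m * ccT k) := by
    intro m
    have : ccP (k + 1) (x + m * ccT k) = ccP k (x + m * ccT k) * ccG k (x + m * ccT k) := by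
      unfold ccP
      rw [Finset.prod_Ico_succ_top hk]
    rw [this, (ccP_periodic k).nat_mul m x]
  simp only [e]
  rw [← Finset.mul_sum, mul_comm]
  exact mul_le_mul_of_nonneg_right (ccG_sum k hk x) (ccP_nonneg k x)

lemma ccI_bound (k : ℕ) (hk : 3 ≤ k) : ccI k ≤ ccI 3 * 3.91 ^ k := by
  induction k, hk using Nat.le_induction with
  | base =>
    have : 0 ≤ ccI 3 := intervalIntegral.integral_nonneg (ccT_pos 3).le fun x _ => ccP_nonneg 3 x
    nlinarith
  | succ k hk ih =>
    have := ccI_succ k hk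
    rw [pow_succ]
    linarith

lemma cc_multipliable (n : ℕ) : Multipliable fun j : ℕ => Real.cos (3 * n / (4 * 3 ^ (j + 1))) := by
  have h : Summable fun j : ℕ => ‖Real.cos (3 * n / (4 * 3 ^ (j + 1))) - 1‖ := by
    have hs : Summable fun j : ℕ => (n : ℝ) ^ 2 * (1 / 9 : ℝ) ^ j :=
      (summable_geometric_of_lt_one (by norm_num) (by norm_num)).mul_left _
    refine Summable.of_nonneg_of_le (fun _ => norm_nonneg _) (fun j => ?_) hs
    have h1 := Real.one_sub_sq_div_two_le_cos (x := 3 * n / (4 * 3 ^ (j + 1)))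
    have h2 := Real.cos_le_one (3 * n / (4 * 3 ^ (j + 1)))
    rw [Real.norm_eq_abs, abs_le]
    have e : (3 * n / (4 * 3 ^ (j + 1)) : ℝ) ^ 2 = (n : ℝ) ^ 2 * (1 / 9 : ℝ) ^ j / 16 := by
      rw [one_div, inv_pow, show (9 : ℝ) = 3 ^ 2 by norm_num, ← pow_mul]
      field_simp
      ring
    have : 0 ≤ (n : ℝ) ^ 2 * (1 / 9 : ℝ) ^ j := by positivity
    constructor <;> linarith
  have := multipliable_one_add_of_summable h
  simpa using this

lemma cc_tendsto (n : ℕ) : Filter.Tendsto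
    (fun k => ∏ j ∈ Finset.range k, Real.cos (n * (1 / (4 * 3 ^ j)))) Filter.atTop
    (nhds (cantorR n)) := by
  have := (cc_multipliable n).hasProd.tendsto_prod_nat
  have e : ∀ j : ℕ, (3 * n / (4 * 3 ^ (j + 1)) : ℝ) = n * (1 / (4 * 3 ^ j)) := by
    intro j; field_simp; ring
  simp only [e] at this
  unfold cantorR
  simpa only [e] using this

lemma cc_prod_subset {s t : Finset ℕ} {f : ℕ → ℝ} (hst : s ⊆ t) (h0 : ∀ i, 0 ≤ f i)
    (h1 : ∀ i, f i ≤ 1) : ∏ i ∈ t, f i ≤ ∏ i ∈ s, f i := by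
  rw [← Finset.prod_sdiff hst]
  exact mul_le_of_le_one_left (Finset.prod_nonneg fun i _ => h0 i)
    (Finset.prod_le_one (fun i _ => h0 i) fun i _ => h1 i)

lemma cc_abs_le (n k : ℕ) : |cantorR n| ≤
    ∏ l ∈ Finset.Ico 3 k, (|Real.cos (n * (1 / (4 * 3 ^ (2 * l))))|
      * |Real.cos (n * (1 / (4 * 3 ^ (2 * l + 1))))|) := by
  refine le_of_tendsto (cc_tendsto n).abs ?_
  filter_upwards [Filter.eventually_ge_atTop (2 * k)] with m hm
  rw [Finset.abs_prod]
  have h1 : ∏ j ∈ Finset.range m, |Real.cos (n * (1 / (4 * 3 ^ j)))|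
      ≤ ∏ j ∈ Finset.range (2 * k), |Real.cos (n * (1 / (4 * 3 ^ j)))| := by
    apply cc_prod_subset
    · intro a; simp; omega
    · intros; positivity
    · intros; exact Real.abs_cos_le_one _
  refine h1.trans ?_
  have h2 : ∏ j ∈ Finset.range (2 * k), |Real.cos (n * (1 / (4 * 3 ^ j)))|
      = ∏ l ∈ Finset.range k, (|Real.cos (n * (1 / (4 * 3 ^ (2 * l))))|
      * |Real.cos (n * (1 / (4 * 3 ^ (2 * l + 1))))|) := by
    clear h1 hm
    induction k with
    | zero => simp
    | succ k ih => rw [show 2 * (k + 1) = 2 * k + 1 + 1 by ring, Finset.prod_range_succ,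
        Finset.prod_range_succ, Finset.prod_range_succ, ih, mul_assoc]
  rw [h2]
  apply cc_prod_subset
  · intro a; simp
  · intros; positivity
  · intros; exact mul_le_one₀ (Real.abs_cos_le_one _) (abs_nonneg _) (Real.abs_cos_le_one _)

lemma ccg_shift (n j : ℕ) (x : ℝ) (h1 : (n : ℝ) ≤ x) (h2 : x ≤ n + 1) :
    |Real.cos (n * (1 / (4 * 3 ^ j)))| ≤ ccg j x := by
  unfold ccg
  have hd : (0 : ℝ) < 1 / (4 * 3 ^ j) := by positivity
  generalize (1 : ℝ) / (4 * 3 ^ j) = d at *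
  have h := Real.abs_cos_sub_cos_le (n * d) (x * d)
  have h3 : |n * d - x * d| ≤ d := by
    rw [abs_le]; constructor <;> nlinarith
  have h4 := abs_sub_abs_le_abs_sub (Real.cos (n * d)) (Real.cos (x * d))
  linarith

lemma cc_le_P (n k : ℕ) (x : ℝ) (h1 : (n : ℝ) ≤ x) (h2 : x ≤ n + 1) : |cantorR n| ≤ ccP k x := by
  refine (cc_abs_le n k).trans ?_
  unfold ccP ccG
  apply Finset.prod_le_prod
  · intros; positivity
  · intro l _
    exact mul_le_mul (ccg_shift n _ x h1 h2) (ccg_shift n _ x h1 h2) (abs_nonneg _) (ccg_nonneg _ _)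

lemma cc_sum_le (k : ℕ) : ∑ n ∈ Finset.range (9 ^ k), |cantorR n| ≤ ccI k := by
  have h1 : ∀ n ∈ Finset.range (9 ^ k), |cantorR n| ≤ ∫ x in (n : ℝ)..((n + 1 : ℕ) : ℝ), ccP k x := by
    intro n _
    have : |cantorR n| = ∫ x in (n : ℝ)..((n + 1 : ℕ) : ℝ), |cantorR n| := by simp
    rw [this]
    apply intervalIntegral.integral_mono_on (by simp)
    · simp
    · exact (ccP_cont k).intervalIntegrable _ _
    · intro x hx
      refine cc_le_P n k x hx.1 (by simpa using hx.2)
  refine (Finset.sum_le_sum h1).trans ?_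
  rw [intervalIntegral.sum_integral_adjacent_intervals (a := fun n : ℕ => (n : ℝ))
    (fun m _ => (ccP_cont k).intervalIntegrable _ _)]
  unfold ccI
  apply intervalIntegral.integral_mono_interval
  · simp
  · simp
  · unfold ccT; push_cast
    have : (0 : ℝ) < 9 ^ k := by positivity
    nlinarith [Real.pi_gt_three]
  · exact Filter.Eventually.of_forall fun x => ccP_nonneg k x
  · exact (ccP_cont k).intervalIntegrable _ _

lemma cc_sum_bound : ∃ C : ℝ, 0 ≤ C ∧ ∀ k, ∑ n ∈ Finset.range (9 ^ k), |cantorR n| ≤ C * 3.91 ^ k := by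
  have h3 : 0 ≤ ccI 3 := intervalIntegral.integral_nonneg (ccT_pos 3).le fun x _ => ccP_nonneg 3 x
  refine ⟨ccI 3 * 3.91 ^ 3, by positivity, fun k => ?_⟩
  rcases le_total 3 k with hk | hk
  · refine (cc_sum_le k).trans ((ccI_bound k hk).trans ?_)
    have : ccI 3 * 3.91 ^ k ≤ (ccI 3 * 3.91 ^ k) * 3.91 ^ 3 :=
      le_mul_of_one_le_right (by positivity) (by norm_num)
    linarith
  · have h5 := (cc_sum_le 3).trans (ccI_bound 3 le_rfl)
    have h6 : 9 ^ k ≤ 9 ^ 3 := Nat.pow_le_pow_right (by norm_num) hk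
    generalize 9 ^ 3 = M at h5 h6
    have h4 : ∑ n ∈ Finset.range (9 ^ k), |cantorR n| ≤ ∑ n ∈ Finset.range M, |cantorR n| := by
      apply Finset.sum_le_sum_of_subset_of_nonneg
      · exact Finset.range_subset_range.2 h6
      · intros; positivity
    refine (h4.trans h5).trans ?_
    exact le_mul_of_one_le_right (by positivity) (one_le_pow₀ (by norm_num))

lemma cc_abel (u c : ℕ → ℂ) (N M : ℕ) (hNM : N ≤ M)
    (hu : ∀ n, N ≤ n → u n = c n * (u n - u (n + 1))) :
    ∑ n ∈ Finset.Ico N M, u n = c N * u N - c M * u M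
      + ∑ n ∈ Finset.Ico N M, (c (n + 1) - c n) * u (n + 1) := by
  induction M, hNM using Nat.le_induction with
  | base => simp
  | succ M hM ih =>
    rw [Finset.sum_Ico_succ_top hM, Finset.sum_Ico_succ_top hM, ih]
    have := hu M hM
    linear_combination this

lemma cc_abel_bound (u c : ℕ → ℂ) (l : ℕ → ℝ) (N M : ℕ) (hNM : N ≤ M)
    (hu : ∀ n, N ≤ n → u n = c n * (u n - u (n + 1))) (hu1 : ∀ n, N ≤ n → ‖u n‖ ≤ 1)
    (hc : ∀ n, N ≤ n → ‖c n‖ ≤ 10) (hl : ∀ n, 0 ≤ l n)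
    (hd : ∀ n, N ≤ n → ‖c (n + 1) - c n‖ ≤ l n - l (n + 1)) (hN : l N ≤ 5) :
    ‖∑ n ∈ Finset.Ico N M, u n‖ ≤ 25 := by
  rw [cc_abel u c N M hNM hu]
  have h1 : ‖c N * u N‖ ≤ 10 * 1 := by
    rw [norm_mul]; exact mul_le_mul (hc N le_rfl) (hu1 N le_rfl) (norm_nonneg _) (by norm_num)
  have h2 : ‖c M * u M‖ ≤ 10 * 1 := by
    rw [norm_mul]; exact mul_le_mul (hc M hNM) (hu1 M hNM) (norm_nonneg _) (by norm_num)
  have h3 : ‖∑ n ∈ Finset.Ico N M, (c (n + 1) - c n) * u (n + 1)‖ ≤ l N - l M := by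
    have : l N - l M = ∑ n ∈ Finset.Ico N M, (l n - l (n + 1)) := by
      have := Finset.sum_Ico_sub l hNM
      rw [← neg_sub, ← this, ← Finset.sum_neg_distrib]
      simp
    rw [this]
    apply norm_sum_le_of_le
    intro n hn
    have hn := (Finset.mem_Ico.1 hn).1
    rw [norm_mul]
    exact (mul_le_of_le_one_right (norm_nonneg _) (hu1 _ (by omega))).trans (hd n hn)
  have h4 := norm_add_le (c N * u N - c M * u M)
    (∑ n ∈ Finset.Ico N M, (c (n + 1) - c n) * u (n + 1))
  have h5 := norm_sub_le (c N * u N) (c M * u M)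
  have := hl M
  linarith

/-- Difference of consecutive logarithms. -/
noncomputable def ccl (n : ℕ) : ℝ := Real.log (n + 1) - Real.log n

lemma ccl_nonneg (n : ℕ) : 0 ≤ ccl n := by
  unfold ccl
  rcases Nat.eq_zero_or_pos n with rfl | h
  · simp
  · have h' : (0 : ℝ) < n := by exact_mod_cast h
    have := Real.log_le_log h' (by linarith : (n : ℝ) ≤ n + 1)
    linarith

lemma ccl_eq (n : ℕ) (hn : 1 ≤ n) : ccl n = Real.log (1 + 1 / n) := by
  have h' : (0 : ℝ) < n := by exact_mod_cast hn
  unfold ccl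
  rw [← Real.log_div (by positivity) (by positivity)]
  congr 1
  field_simp

lemma ccl_le (n : ℕ) (hn : 1 ≤ n) : ccl n ≤ 1 / n := by
  have h' : (0 : ℝ) < n := by exact_mod_cast hn
  rw [ccl_eq n hn]
  have := Real.log_le_sub_one_of_pos (x := 1 + 1 / (n : ℝ)) (by positivity)
  linarith

lemma ccl_anti (n : ℕ) (hn : 1 ≤ n) : ccl (n + 1) ≤ ccl n := by
  have h' : (0 : ℝ) < n := by exact_mod_cast hn
  rw [ccl_eq n hn, ccl_eq (n + 1) (by omega)]
  apply Real.log_le_log (by positivity)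
  push_cast
  gcongr
  linarith

lemma cc_kuzmin (x : ℝ) (hx : |x - 5 / 4| ≤ 3 / 8) (s : ℂ) (hs : 0 ≤ s.re) (N M : ℕ) (hN : 1 ≤ N)
    (hNs : 40 * ‖s‖ ≤ N) (hNM : N ≤ M) :
    ‖∑ n ∈ Finset.Ico N M, Complex.exp (Complex.I * x * n) * (n : ℂ) ^ (-s)‖ ≤ 25 := by
  set q : ℕ → ℂ := fun n => Complex.exp (Complex.I * x) * Complex.exp (-s * (ccl n : ℝ)) with hq
  have hexp : ∀ y : ℝ, 0 ≤ y → ‖Complex.exp (-s * (y : ℝ))‖ ≤ 1 := by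
    intro y hy
    rw [Complex.norm_exp]
    simp only [Complex.mul_re, Complex.neg_re, Complex.ofReal_re, Complex.ofReal_im, mul_zero,
      sub_zero]
    rw [Real.exp_le_one_iff]
    nlinarith
  have hI : ∀ y : ℝ, ‖Complex.exp (Complex.I * y)‖ = 1 := by
    intro y; rw [mul_comm]; exact Complex.norm_exp_ofReal_mul_I y
  have hNpos : (0 : ℝ) < N := by exact_mod_cast hN
  have hsl : ∀ n, N ≤ n → ‖s‖ * ccl n ≤ 1 / 40 := by
    intro n hn
    have hn' : (N : ℝ) ≤ n := by exact_mod_cast hn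
    have h1 := ccl_le n (by omega)
    have h2 : (1 : ℝ) / n ≤ 1 / N := one_div_le_one_div_of_le hNpos hn'
    have h3 : ‖s‖ * ccl n ≤ ‖s‖ * (1 / N) :=
      mul_le_mul_of_nonneg_left (h1.trans h2) (norm_nonneg _)
    refine h3.trans ?_
    rw [mul_one_div, div_le_iff₀ hNpos]
    linarith
  have hlow : ∀ n, N ≤ n → 1 / 10 ≤ ‖1 - q n‖ := by
    intro n hn
    have h1 : ‖1 - Complex.exp (Complex.I * x)‖ ≥ 0.15 := by
      have := Complex.re_le_norm (1 - Complex.exp (Complex.I * x))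
      rw [mul_comm, Complex.sub_re, Complex.exp_ofReal_mul_I_re, Complex.one_re] at this
      rw [abs_le] at hx
      have hpi : Real.pi ^ 2 ≤ 10 := by nlinarith [Real.pi_lt_d2, Real.pi_pos]
      have hc := Real.cos_le_one_sub_mul_cos_sq (x := x) (by
        rw [abs_le]; constructor <;> linarith [Real.pi_gt_three])
      have h4 : (2 : ℝ) / 10 ≤ 2 / Real.pi ^ 2 :=
        div_le_div_of_nonneg_left (by norm_num) (by positivity) hpi
      have h5 : (49 / 64 : ℝ) ≤ x ^ 2 := by nlinarith
      rw [mul_comm]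
      nlinarith
    have h2 : ‖Complex.exp (-s * (ccl n : ℝ)) - 1‖ ≤ 0.05 := by
      have hz : ‖-s * (ccl n : ℝ)‖ ≤ 1 / 40 := by
        rw [norm_mul, norm_neg, Complex.norm_real, Real.norm_of_nonneg (ccl_nonneg n)]
        exact hsl n hn
      have := Complex.norm_exp_sub_one_le (x := -s * (ccl n : ℝ)) (by linarith)
      linarith
    have h3 : 1 - Complex.exp (Complex.I * x) = (1 - q n)
        + Complex.exp (Complex.I * x) * (Complex.exp (-s * (ccl n : ℝ)) - 1) := by
      simp only [hq]; ring
    have h4 := norm_add_le (1 - q n)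
      (Complex.exp (Complex.I * x) * (Complex.exp (-s * (ccl n : ℝ)) - 1))
    rw [← h3, norm_mul, hI] at h4
    linarith
  refine cc_abel_bound _ (fun n => 1 / (1 - q n)) (fun n => 200 * ‖s‖ * ccl n) N M hNM ?_ ?_ ?_ ?_ ?_ ?_
  · intro n hn
    have hne : (n : ℂ) ≠ 0 := by exact_mod_cast (by omega : n ≠ 0)
    have hne' : ((n + 1 : ℕ) : ℂ) ≠ 0 := by exact_mod_cast (by omega : n + 1 ≠ 0)
    have hq1 : 1 - q n ≠ 0 := by
      have := hlow n hn
      intro h; rw [h, norm_zero] at this; norm_num at this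
    have key : Complex.exp (Complex.I * x * (n + 1 : ℕ)) * ((n + 1 : ℕ) : ℂ) ^ (-s)
        = q n * (Complex.exp (Complex.I * x * n) * (n : ℂ) ^ (-s)) := by
      rw [Complex.cpow_def_of_ne_zero hne, Complex.cpow_def_of_ne_zero hne',
        ← Complex.natCast_log, ← Complex.natCast_log]
      simp only [hq, ← Complex.exp_add]
      congr 1
      unfold ccl
      push_cast
      ring
    rw [key]
    field_simp
  · intro n hn
    have hne : (n : ℂ) ≠ 0 := by exact_mod_cast (by omega : n ≠ 0)
    have e : Complex.I * x * n = Complex.I * ((x * n : ℝ) : ℂ) := by push_cast; ring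
    rw [norm_mul, e, hI, one_mul, Complex.cpow_def_of_ne_zero hne, ← Complex.natCast_log, mul_comm]
    exact hexp _ (Real.log_natCast_nonneg n)
  · intro n hn
    rw [norm_div, norm_one, div_le_iff₀ (by linarith [hlow n hn])]
    linarith [hlow n hn]
  · intro n
    have := ccl_nonneg n
    positivity
  · intro n hn
    have a1 := hlow n hn
    have a2 := hlow (n + 1) (by omega)
    have n1 : 1 - q n ≠ 0 := by intro h; rw [h, norm_zero] at a1; norm_num at a1
    have n2 : 1 - q (n + 1) ≠ 0 := by intro h; rw [h, norm_zero] at a2; norm_num at a2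
    have e : 1 / (1 - q (n + 1)) - 1 / (1 - q n) = (q (n + 1) - q n) / ((1 - q (n + 1)) * (1 - q n)) := by
      field_simp
      ring
    have hq2 : ‖q (n + 1) - q n‖ ≤ 2 * (‖s‖ * (ccl n - ccl (n + 1))) := by
      have e2 : q (n + 1) - q n = Complex.exp (Complex.I * x) * Complex.exp (-s * (ccl n : ℝ))
          * (Complex.exp (s * ((ccl n - ccl (n + 1) : ℝ) : ℂ)) - 1) := by
        simp only [hq]
        rw [mul_sub, mul_one, ← Complex.exp_add, ← Complex.exp_add, ← Complex.exp_add]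
        congr 2
        push_cast; ring
      have hnn : 0 ≤ ccl n - ccl (n + 1) := sub_nonneg.2 (ccl_anti n (by omega))
      have hz : ‖s * ((ccl n - ccl (n + 1) : ℝ) : ℂ)‖ = ‖s‖ * (ccl n - ccl (n + 1)) := by
        rw [norm_mul, Complex.norm_real, Real.norm_of_nonneg hnn]
      have hz1 : ‖s * ((ccl n - ccl (n + 1) : ℝ) : ℂ)‖ ≤ 1 := by
        rw [hz, mul_sub]
        have := hsl n hn
        have := mul_nonneg (norm_nonneg s) (ccl_nonneg (n + 1))
        linarith
      have h3 := Complex.norm_exp_sub_one_le hz1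
      rw [hz] at h3
      rw [e2, norm_mul, norm_mul, hI, one_mul]
      exact (mul_le_of_le_one_left (norm_nonneg _) (hexp _ (ccl_nonneg n))).trans h3
    rw [e, norm_div, norm_mul, div_le_iff₀ (by positivity)]
    have hp : 1 / 100 ≤ ‖1 - q (n + 1)‖ * ‖1 - q n‖ := by nlinarith
    have hnn : 0 ≤ ‖s‖ * (ccl n - ccl (n + 1)) :=
      mul_nonneg (norm_nonneg _) (sub_nonneg.2 (ccl_anti n (by omega)))
    nlinarith [mul_le_mul_of_nonneg_left hp hnn]
  · have := hsl N le_rfl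
    linarith

lemma cc_average (S : Finset ℕ) (v : ℕ → ℂ) (h : ℕ → ℝ) (K : ℝ) (k : ℕ) : ∀ c : ℝ,
    (∀ x : ℝ, |x - c| ≤ ∑ j ∈ Finset.range k, |h j| →
      ‖∑ n ∈ S, Complex.exp (Complex.I * x * n) * v n‖ ≤ K) →
    ‖∑ n ∈ S, Complex.exp (Complex.I * c * n)
      * ((∏ j ∈ Finset.range k, Real.cos (n * h j) : ℝ) : ℂ) * v n‖ ≤ K := by
  induction k with
  | zero =>
    intro c hc
    simpa using hc c (by simp)
  | succ k ih =>
    intro c hc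
    have h1 := ih (c + h k) (fun x hx => hc x (by
      rw [Finset.sum_range_succ]
      have := abs_add_le (x - (c + h k)) (h k)
      rw [show x - (c + h k) + h k = x - c by ring] at this
      linarith))
    have h2 := ih (c - h k) (fun x hx => hc x (by
      rw [Finset.sum_range_succ]
      have := abs_sub (x - (c - h k)) (h k)
      rw [show x - (c - h k) - h k = x - c by ring] at this
      linarith))
    have e : ∑ n ∈ S, Complex.exp (Complex.I * c * n)
      * ((∏ j ∈ Finset.range (k + 1), Real.cos (n * h j) : ℝ) : ℂ) * v n
      = (1 / 2 : ℂ) * (∑ n ∈ S, Complex.exp (Complex.I * (c + h k : ℝ) * n)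
      * ((∏ j ∈ Finset.range k, Real.cos (n * h j) : ℝ) : ℂ) * v n
      + ∑ n ∈ S, Complex.exp (Complex.I * (c - h k : ℝ) * n)
      * ((∏ j ∈ Finset.range k, Real.cos (n * h j) : ℝ) : ℂ) * v n) := by
      rw [← Finset.sum_add_distrib, Finset.mul_sum]
      apply Finset.sum_congr rfl
      intro n _
      rw [Finset.prod_range_succ, Complex.ofReal_mul]
      generalize ((∏ j ∈ Finset.range k, Real.cos (n * h j) : ℝ) : ℂ) = p
      have e1 : Complex.I * (c + h k : ℝ) * n = Complex.I * c * n + ((n * h k : ℝ) : ℂ) * Complex.I := by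
        push_cast; ring
      have e2 : Complex.I * (c - h k : ℝ) * n = Complex.I * c * n + -((n * h k : ℝ) : ℂ) * Complex.I := by
        push_cast; ring
      rw [e1, e2, Complex.exp_add, Complex.exp_add, Complex.ofReal_cos, Complex.cos]
      ring
    rw [e, norm_mul]
    have h3 := norm_add_le (∑ n ∈ S, Complex.exp (Complex.I * (c + h k : ℝ) * n)
      * ((∏ j ∈ Finset.range k, Real.cos (n * h j) : ℝ) : ℂ) * v n)
      (∑ n ∈ S, Complex.exp (Complex.I * (c - h k : ℝ) * n)
      * ((∏ j ∈ Finset.range k, Real.cos (n * h j) : ℝ) : ℂ) * v n)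
    have h4 : ‖(1 / 2 : ℂ)‖ = 1 / 2 := by norm_num
    rw [h4]
    linarith

lemma cc_sum_h (k : ℕ) : ∑ j ∈ Finset.range k, |(1 / (4 * 3 ^ j) : ℝ)| ≤ 3 / 8 := by
  have : ∑ j ∈ Finset.range k, |(1 / (4 * 3 ^ j) : ℝ)| = 3 / 8 - 3 / 8 / 3 ^ k := by
    induction k with
    | zero => norm_num
    | succ k ih =>
      rw [Finset.sum_range_succ, ih, abs_of_nonneg (by positivity)]
      field_simp
      ring
  rw [this]
  have : (0 : ℝ) ≤ 3 / 8 / 3 ^ k := by positivity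
  linarith

lemma cc_tail (s : ℂ) (hs : 0 ≤ s.re) (N M : ℕ) (hN : 1 ≤ N)
    (hNs : 40 * ‖s‖ ≤ N) (hNM : N ≤ M) :
    ‖∑ n ∈ Finset.Ico N M, cantorA n * (n : ℂ) ^ (-s)‖ ≤ 25 := by
  have ht : Filter.Tendsto (fun k => ∑ n ∈ Finset.Ico N M, Complex.exp (Complex.I * (5 / 4 : ℝ) * n)
      * ((∏ j ∈ Finset.range k, Real.cos (n * (1 / (4 * 3 ^ j))) : ℝ) : ℂ) * (n : ℂ) ^ (-s))
      Filter.atTop (nhds (∑ n ∈ Finset.Ico N M, cantorA n * (n : ℂ) ^ (-s))) := by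
    apply tendsto_finsetSum
    intro n _
    have h1 := (Complex.continuous_ofReal.tendsto _).comp (cc_tendsto n)
    have h2 := (h1.const_mul (Complex.exp (Complex.I * (5 / 4 : ℝ) * n))).mul_const ((n : ℂ) ^ (-s))
    have e : cantorA n = Complex.exp (Complex.I * (5 / 4 : ℝ) * n) * (cantorR n : ℂ) := by
      unfold cantorA; push_cast; rfl
    rw [e]
    exact h2
  refine le_of_tendsto ht.norm (Filter.Eventually.of_forall fun k => ?_)
  apply cc_average (Finset.Ico N M) (fun n => (n : ℂ) ^ (-s)) (fun j => 1 / (4 * 3 ^ j)) 25 k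
  intro x hx
  exact cc_kuzmin x (hx.trans (cc_sum_h k)) s hs N M hN hNs hNM

lemma cantorA_norm (n : ℕ) : ‖cantorA n‖ = |cantorR n| := by
  unfold cantorA
  have e : Complex.I * (5 / 4) * n = ((5 / 4 * n : ℝ) : ℂ) * Complex.I := by push_cast; ring
  rw [norm_mul, e, Complex.norm_exp_ofReal_mul_I, one_mul, Complex.norm_real, Real.norm_eq_abs]

lemma cantorA_le_one (n : ℕ) : ‖cantorA n‖ ≤ 1 := by
  rw [cantorA_norm]
  simpa using cc_abs_le n 0

lemma cc_weighted : ∃ D : ℝ, 0 ≤ D ∧ ∀ k, ∑ n ∈ Finset.range (9 ^ k), |cantorR n| * (n : ℝ) ^ (-(1 / 2) : ℝ)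
    ≤ D * (3.91 / 3) ^ k := by
  obtain ⟨C, hC, h⟩ := cc_sum_bound
  refine ⟨13 * C, by positivity, fun k => ?_⟩
  induction k with
  | zero =>
    simp [Real.zero_rpow]
    positivity
  | succ k ih =>
    have hle : 9 ^ k ≤ 9 ^ (k + 1) := Nat.pow_le_pow_right (by norm_num) (by omega)
    rw [← Finset.sum_range_add_sum_Ico _ hle]
    have h1 : ∑ n ∈ Finset.Ico (9 ^ k) (9 ^ (k + 1)), |cantorR n| * (n : ℝ) ^ (-(1 / 2) : ℝ)
        ≤ ∑ n ∈ Finset.Ico (9 ^ k) (9 ^ (k + 1)), |cantorR n| * (1 / 3 ^ k) := by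
      apply Finset.sum_le_sum
      intro n hn
      have hn := (Finset.mem_Ico.1 hn).1
      have hn' : ((9 : ℝ) ^ k) ≤ n := by exact_mod_cast hn
      apply mul_le_mul_of_nonneg_left _ (abs_nonneg _)
      have e : (1 / 3 ^ k : ℝ) = ((9 : ℝ) ^ k) ^ (-(1 / 2) : ℝ) := by
        rw [Real.rpow_neg (by positivity), ← Real.sqrt_eq_rpow,
          show (9 : ℝ) ^ k = (3 ^ k) ^ 2 by rw [← pow_mul, mul_comm, pow_mul]; norm_num,
          Real.sqrt_sq (by positivity), one_div]
      rw [e]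
      exact Real.rpow_le_rpow_of_nonpos (by positivity) hn' (by norm_num)
    rw [← Finset.sum_mul] at h1
    have h2 : ∑ n ∈ Finset.Ico (9 ^ k) (9 ^ (k + 1)), |cantorR n|
        ≤ ∑ n ∈ Finset.range (9 ^ (k + 1)), |cantorR n| := by
      apply Finset.sum_le_sum_of_subset_of_nonneg
      · intro a; simp
      · intros; positivity
    have h3 := h2.trans (h (k + 1))
    have h4 : (0 : ℝ) < 1 / 3 ^ k := by positivity
    have h5 := h1.trans (mul_le_mul_of_nonneg_right h3 h4.le)
    have e1 : C * 3.91 ^ (k + 1) * (1 / 3 ^ k) = 3.91 * C * (3.91 / 3) ^ k := by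
      rw [div_pow, pow_succ]; field_simp
    rw [e1] at h5
    have h6 : (0 : ℝ) ≤ C * (3.91 / 3) ^ k := by positivity
    refine (add_le_add ih h5).trans ?_
    rw [pow_succ (3.91 / 3 : ℝ) k]
    nlinarith [h6]

/-- Partial sums of the coefficients. -/
noncomputable def ccA (n : ℕ) : ℂ := ∑ i ∈ Finset.range n, cantorA (i + 1)

noncomputable def ccb (s : ℂ) (n : ℕ) : ℂ := ((n + 1 : ℕ) : ℂ) ^ (-s)

lemma ccA_bound (n : ℕ) : ‖ccA n‖ ≤ 25 := by
  have h := cc_tail 0 (by simp) 1 (n + 1) le_rfl (by simp) (by omega)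
  unfold ccA
  rw [Finset.range_eq_Ico, Finset.sum_Ico_add' (fun i => cantorA i) 0 n 1]
  simpa using h

lemma cc_partial (s : ℂ) (M : ℕ) : ∑ n ∈ Finset.range M, cantorA (n + 1) * ccb s n
    = ccA M * ccb s M + ∑ n ∈ Finset.range M, ccA (n + 1) * (ccb s n - ccb s (n + 1)) := by
  induction M with
  | zero => simp [ccA]
  | succ M ih =>
    rw [Finset.sum_range_succ, Finset.sum_range_succ, ih]
    have : ccA (M + 1) = ccA M + cantorA (M + 1) := by unfold ccA; rw [Finset.sum_range_succ]
    rw [this]; ring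

lemma ccb_diff (s : ℂ) (δ R : ℝ) (h1 : δ ≤ s.re) (hR : ‖s‖ ≤ R) (hδ : 0 < δ) (n : ℕ) :
    ‖ccb s n - ccb s (n + 1)‖ ≤ R * Real.exp R * (((n + 1 : ℕ) : ℝ) ^ (-(1 + δ))) := by
  have hne : ((n + 1 : ℕ) : ℂ) ≠ 0 := by exact_mod_cast (by omega : n + 1 ≠ 0)
  have hne' : ((n + 1 + 1 : ℕ) : ℂ) ≠ 0 := by exact_mod_cast (by omega : n + 1 + 1 ≠ 0)
  have hpos : (0 : ℝ) < ((n + 1 : ℕ) : ℝ) := by exact_mod_cast (by omega : 0 < n + 1)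
  have hone : (1 : ℝ) ≤ ((n + 1 : ℕ) : ℝ) := by exact_mod_cast (by omega : 1 ≤ n + 1)
  have e : ccb s n - ccb s (n + 1) = -(ccb s n * (Complex.exp (-s * (ccl (n + 1) : ℝ)) - 1)) := by
    have : ccb s (n + 1) = ccb s n * Complex.exp (-s * (ccl (n + 1) : ℝ)) := by
      unfold ccb
      rw [Complex.cpow_def_of_ne_zero hne, Complex.cpow_def_of_ne_zero hne',
          ← Complex.natCast_log, ← Complex.natCast_log, ← Complex.exp_add]
      congr 1
      unfold ccl
      push_cast
      ring
    rw [this]; ring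
  rw [e, norm_neg, norm_mul]
  have b1 : ‖ccb s n‖ ≤ ((n + 1 : ℕ) : ℝ) ^ (-δ) := by
    unfold ccb
    rw [Complex.norm_natCast_cpow_of_pos (by omega)]
    apply Real.rpow_le_rpow_of_exponent_le hone
    simpa using h1
  have hl := ccl_le (n + 1) (by omega)
  have hl0 := ccl_nonneg (n + 1)
  have hR0 : 0 ≤ R := (norm_nonneg s).trans hR
  have hz : ‖-s * (ccl (n + 1) : ℝ)‖ ≤ R * (1 / ((n + 1 : ℕ) : ℝ)) := by
    rw [norm_mul, norm_neg, Complex.norm_real, Real.norm_of_nonneg hl0]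
    exact mul_le_mul hR hl hl0 hR0
  have hz' : ‖-s * (ccl (n + 1) : ℝ)‖ ≤ R := by
    refine hz.trans (mul_le_of_le_one_right hR0 ?_)
    rw [div_le_one hpos]; exact hone
  have b2 := Complex.norm_exp_sub_sum_le_norm_mul_exp (-s * (ccl (n + 1) : ℝ)) 1
  simp only [Finset.sum_range_one, pow_zero, Nat.factorial_zero, Nat.cast_one, div_one, pow_one] at b2
  have b3 : ‖Complex.exp (-s * (ccl (n + 1) : ℝ)) - 1‖ ≤ R * (1 / ((n + 1 : ℕ) : ℝ)) * Real.exp R := by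
    refine b2.trans (mul_le_mul hz (Real.exp_le_exp.2 hz') (Real.exp_pos _).le (by positivity))
  refine (mul_le_mul b1 b3 (norm_nonneg _) (by positivity)).trans (le_of_eq ?_)
  rw [neg_add, Real.rpow_add hpos, Real.rpow_neg_one]
  ring

lemma cc_summable (δ C : ℝ) (hδ : 0 < δ) : Summable fun n : ℕ => C * (((n + 1 : ℕ) : ℝ) ^ (-(1 + δ))) := by
  apply Summable.mul_left
  have := (Real.summable_nat_rpow (p := -(1 + δ))).2 (by linarith)
  exact (summable_nat_add_iff 1).2 this

noncomputable def ccGf (s : ℂ) : ℂ := ∑' n : ℕ, ccA (n + 1) * (ccb s n - ccb s (n + 1))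

lemma cc_term (s : ℂ) (δ R : ℝ) (h1 : δ ≤ s.re) (hR : ‖s‖ ≤ R) (hδ : 0 < δ) (n : ℕ) :
    ‖ccA (n + 1) * (ccb s n - ccb s (n + 1))‖
      ≤ (25 * (R * Real.exp R)) * (((n + 1 : ℕ) : ℝ) ^ (-(1 + δ))) := by
  rw [norm_mul, mul_assoc]
  exact mul_le_mul (ccA_bound _) (ccb_diff s δ R h1 hR hδ n) (norm_nonneg _) (by norm_num)

lemma ccb_differentiable (n : ℕ) : Differentiable ℂ fun s => ccb s n := by
  have hne : ((n + 1 : ℕ) : ℂ) ≠ 0 := by exact_mod_cast (by omega : n + 1 ≠ 0)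
  intro s
  unfold ccb
  exact (differentiableAt_id.neg).const_cpow (Or.inl hne)

lemma ccGf_diff (s : ℂ) (hs : 0 < s.re) : DifferentiableAt ℂ ccGf s := by
  set U : Set ℂ := {z | s.re / 2 < z.re} ∩ Metric.ball 0 (‖s‖ + 1) with hU
  have hUo : IsOpen U := (isOpen_lt continuous_const Complex.continuous_re).inter Metric.isOpen_ball
  have hsU : s ∈ U := by
    refine ⟨?_, ?_⟩
    · simp only [Set.mem_setOf_eq]; linarith
    · simp
  have := Complex.differentiableOn_tsum_of_summable_norm
    (F := fun (n : ℕ) s => ccA (n + 1) * (ccb s n - ccb s (n + 1)))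
    (cc_summable (s.re / 2) (25 * ((‖s‖ + 1) * Real.exp (‖s‖ + 1))) (by linarith))
    (fun n => (((ccb_differentiable n).sub (ccb_differentiable (n + 1))).const_mul _).differentiableOn)
    hUo (fun n w hw => cc_term w (s.re / 2) (‖s‖ + 1) hw.1.le
      (by simpa using (mem_ball_zero_iff.1 hw.2).le) (by linarith) n)
  exact this.differentiableAt (hUo.mem_nhds hsU)

lemma cc_partial_tendsto (s : ℂ) (hs : 0 < s.re) :
    Filter.Tendsto (fun M => ∑ n ∈ Finset.range M, cantorA (n + 1) * ccb s n) Filter.atTop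
      (nhds (ccGf s)) := by
  simp only [cc_partial]
  have hsum : Summable fun n : ℕ => ccA (n + 1) * (ccb s n - ccb s (n + 1)) :=
    Summable.of_norm_bounded (cc_summable s.re (25 * (‖s‖ * Real.exp ‖s‖)) hs)
      (fun n => cc_term s s.re ‖s‖ le_rfl le_rfl hs n)
  have h1 := hsum.hasSum.tendsto_sum_nat
  have h2 : Filter.Tendsto (fun M => ccA M * ccb s M) Filter.atTop (nhds 0) := by
    have h3 : Filter.Tendsto (fun M : ℕ => 25 * (((M + 1 : ℕ) : ℝ) ^ (-s.re))) Filter.atTop (nhds 0) := by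
      have := ((tendsto_rpow_neg_atTop hs).comp tendsto_natCast_atTop_atTop).comp
        (Filter.tendsto_add_atTop_nat 1)
      simpa using this.const_mul 25
    refine squeeze_zero_norm (fun M => ?_) h3
    rw [norm_mul]
    refine mul_le_mul (ccA_bound _) ?_ (norm_nonneg _) (by norm_num)
    unfold ccb
    rw [Complex.norm_natCast_cpow_of_pos (by omega)]
    simp
  simpa [ccGf] using h2.add h1

lemma cc_series_tendsto (s : ℂ) (hs : 1 < s.re) :
    Filter.Tendsto (fun M => ∑ n ∈ Finset.range M, cantorA (n + 1) * ccb s n) Filter.atTop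
      (nhds (cantorSeries s)) := by
  have hsum : Summable fun n : ℕ => cantorA (n + 1) * ccb s n := by
    refine Summable.of_norm_bounded (cc_summable (s.re - 1) 1 (by linarith)) (fun n => ?_)
    rw [norm_mul]
    refine mul_le_mul (cantorA_le_one _) ?_ (norm_nonneg _) (by norm_num)
    unfold ccb
    rw [Complex.norm_natCast_cpow_of_pos (by omega)]
    apply le_of_eq
    congr 1
    simp
  exact hsum.hasSum.tendsto_sum_nat

lemma cc_L_eq (L : ℂ → ℂ) (hL : Differentiable ℂ L)
    (hLeq : ∀ s : ℂ, 1 < s.re → L s = cantorSeries s) (s : ℂ) (hs : 0 < s.re) : L s = ccGf s := by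
  have hUo : IsOpen {z : ℂ | 0 < z.re} := isOpen_lt continuous_const Complex.continuous_re
  have hA : AnalyticOnNhd ℂ ccGf {z : ℂ | 0 < z.re} :=
    DifferentiableOn.analyticOnNhd (fun z hz => (ccGf_diff z hz).differentiableWithinAt) hUo
  have hB : AnalyticOnNhd ℂ L {z : ℂ | 0 < z.re} := hL.differentiableOn.analyticOnNhd hUo
  refine hB.eqOn_of_preconnected_of_eventuallyEq hA (convex_halfSpace_re_gt 0).isPreconnected
    (z₀ := 2) (by simp) ?_ hs
  have hV : IsOpen {z : ℂ | 1 < z.re} := isOpen_lt continuous_const Complex.continuous_re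
  filter_upwards [hV.mem_nhds (by simp : (2 : ℂ) ∈ {z : ℂ | 1 < z.re})] with z hz
  have hz : 1 < z.re := hz
  rw [hLeq z hz]
  exact tendsto_nhds_unique (cc_series_tendsto z hz) (cc_partial_tendsto z (by linarith))

lemma cc_main (L : ℂ → ℂ) (hL : Differentiable ℂ L)
    (hLeq : ∀ s : ℂ, 1 < s.re → L s = cantorSeries s) : ∃ D : ℝ, 0 ≤ D ∧ ∀ t : ℝ, 2 ≤ t → ∀ k : ℕ,
      50 * t ≤ 9 ^ k → ‖L (1 / 2 + t * Complex.I)‖ ≤ D * (3.91 / 3) ^ k + 25 := by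
  obtain ⟨D, hD, h⟩ := cc_weighted
  refine ⟨D, hD, fun t ht k hk => ?_⟩
  set s : ℂ := 1 / 2 + t * Complex.I with hsdef
  have hre : s.re = 1 / 2 := by simp [hsdef]
  have hs0 : s ≠ 0 := by intro h0; rw [h0] at hre; norm_num at hre
  have hns : ‖s‖ ≤ 1 / 2 + t := by
    refine (norm_add_le _ _).trans (le_of_eq ?_)
    rw [norm_mul, Complex.norm_I, Complex.norm_real, Real.norm_of_nonneg (by linarith)]
    norm_num
  rw [cc_L_eq L hL hLeq s (by rw [hre]; norm_num)]
  refine le_of_tendsto (cc_partial_tendsto s (by rw [hre]; norm_num)).norm ?_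
  filter_upwards [Filter.eventually_ge_atTop (9 ^ k)] with M hM
  have e : ∑ n ∈ Finset.range M, cantorA (n + 1) * ccb s n
      = ∑ n ∈ Finset.range (M + 1), cantorA n * (n : ℂ) ^ (-s) := by
    rw [Finset.sum_range_succ']
    simp [ccb, hs0]
  rw [e, ← Finset.sum_range_add_sum_Ico _ (by omega : 9 ^ k ≤ M + 1)]
  have h1 := cc_tail s (by rw [hre]; norm_num) (9 ^ k) (M + 1) (Nat.one_le_pow _ _ (by norm_num))
    (by push_cast; linarith) (by omega)
  have h2 : ‖∑ n ∈ Finset.range (9 ^ k), cantorA n * (n : ℂ) ^ (-s)‖ ≤ D * (3.91 / 3) ^ k := by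
    refine le_trans (norm_sum_le_of_le _ fun n _ => ?_) (h k)
    rw [norm_mul, cantorA_norm]
    rcases Nat.eq_zero_or_pos n with rfl | hn
    · simp [hs0]
    · rw [Complex.norm_natCast_cpow_of_pos hn, Complex.neg_re, hre]
  exact (norm_add_le _ _).trans (add_le_add h2 h1)

/-- Subconvexity via the fourth moment: `μ_L(1/2) ≤ 1/8`, i.e.
`|L(1/2+it)| ≪_ε t^{1/8+ε}`. -/
theorem cantor_one_eighth
    (L : ℂ → ℂ) (hL : Differentiable ℂ L)
    (hLeq : ∀ s : ℂ, 1 < s.re → L s = cantorSeries s) :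
    ∀ ε : ℝ, 0 < ε → ∃ K : ℝ, ∀ t : ℝ, 2 ≤ t →
      ‖L (1 / 2 + t * Complex.I)‖ ≤ K * t ^ (1 / 8 + ε : ℝ) := by
  intro ε hε
  obtain ⟨D, hD, h⟩ := cc_main L hL hLeq
  refine ⟨D * (450 : ℝ) ^ (1 / 8 : ℝ) + 25, fun t ht => ?_⟩
  have hex : ∃ k : ℕ, 50 * t ≤ 9 ^ k := by
    obtain ⟨k, hk⟩ := pow_unbounded_of_one_lt (50 * t) (by norm_num : (1 : ℝ) < 9)
    exact ⟨k, hk.le⟩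
  classical
  obtain ⟨k, hk, hk2⟩ : ∃ k : ℕ, 50 * t ≤ 9 ^ k ∧ (9 : ℝ) ^ k ≤ 450 * t := by
    refine ⟨Nat.find hex, Nat.find_spec hex, ?_⟩
    rcases Nat.eq_zero_or_pos (Nat.find hex) with h0 | h0
    · rw [h0]; norm_num; linarith
    · have := Nat.find_min hex (m := Nat.find hex - 1) (by omega)
      push Not at this
      have e : Nat.find hex = (Nat.find hex - 1) + 1 := by omega
      rw [e, pow_succ]
      linarith
  have h1 := h t ht k hk
  have h2 : ((3.91 : ℝ) / 3) ^ k ≤ (450 : ℝ) ^ (1 / 8 : ℝ) * t ^ (1 / 8 : ℝ) := by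
    rw [← Real.mul_rpow (by norm_num) (by linarith)]
    have e : ((3.91 : ℝ) / 3) ^ k = ((((3.91 : ℝ) / 3) ^ k) ^ (8 : ℕ)) ^ (1 / 8 : ℝ) := by
      rw [← Real.rpow_natCast _ 8, ← Real.rpow_mul (by positivity)]
      norm_num
    rw [e]
    apply Real.rpow_le_rpow (by positivity) _ (by norm_num)
    refine le_trans ?_ hk2
    rw [← pow_mul, mul_comm, pow_mul]
    exact pow_le_pow_left₀ (by positivity) (by norm_num) k
  have h3 : t ^ (1 / 8 : ℝ) ≤ t ^ (1 / 8 + ε : ℝ) :=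
    Real.rpow_le_rpow_of_exponent_le (by linarith) (by linarith)
  have h4 : (1 : ℝ) ≤ t ^ (1 / 8 + ε : ℝ) := Real.one_le_rpow (by linarith) (by linarith)
  have h5 : (450 : ℝ) ^ (1 / 8 : ℝ) * t ^ (1 / 8 : ℝ) ≤ (450 : ℝ) ^ (1 / 8 : ℝ) * t ^ (1 / 8 + ε : ℝ) :=
    mul_le_mul_of_nonneg_left h3 (by positivity)
  have h6 := mul_le_mul_of_nonneg_left (h2.trans h5) hD
  rw [add_mul, mul_assoc]
  linarith
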